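/- Let π be a permutation of Fin n, let ℓ_0 < n be a position, and let d ≥ 1 be a divisor of p(π ℓ_0). Let p' : Fin (n − 1 + p(π ℓ_0)/d) → ℕ be the job list obtained from the sequence (p(π 0), …, p(π (n−1))) by replacing the entry at position ℓ_0 with p(π ℓ_0)/d consecutive entries equal to d. Then TEC*(p', id) ≤ TEC*(p, π); that is, splitting one job of the sequence into equal consecutive pieces can only decrease the optimal total energy cost for the fixed sequence. -/

import Mathlib

namespace TOU

open Classical in
/-- The infimum of a set of rationals, as an element of `WithTop ℚ`:
the least element of the set when one exists, and `⊤` otherwise.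
(All the sets of achievable total energy costs considered below are finite,
so this is the infimum, and it is `⊤` exactly when the set is empty.) -/
noncomputable def infQ (A : Set ℚ) : WithTop ℚ :=
  if h : ∃ x ∈ A, ∀ y ∈ A, x ≤ y then ((h.choose : ℚ) : WithTop ℚ) else ⊤

open Classical in
/-- The analogous infimum operation for subsets of `WithTop ℚ`. -/
noncomputable def infW (A : Set (WithTop ℚ)) : WithTop ℚ :=
  if h : ∃ x ∈ A, ∀ y ∈ A, x ≤ y then h.choose else ⊤

variable {S : Type*}

/-- A state profile `Ω : Fin h → S × S` is valid if there are `m ≥ 2` states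
`s 0, …, s m` with `s 0 = s 1 = off`, `s (m-1) = s m = off`, such that
`{0, …, h-1}` is the concatenation of consecutive blocks `I_1, …, I_m`
(delimited by the cumulative endpoints `e 0 = 0 ≤ e 1 ≤ ⋯ ≤ e m = h`) where the
`k`-th block has size `T (s (k-1)) (s k)` (in particular this transition time is
not `∞`) and `Ω i = (s (k-1), s k)` for every `i` in the `k`-th block. -/
def ValidProfile (off : S) (T : S → S → ℕ∞) {h : ℕ} (Ω : Fin h → S × S) : Prop :=
  ∃ (m : ℕ) (s : ℕ → S) (e : ℕ → ℕ),
    2 ≤ m ∧ s 0 = off ∧ s 1 = off ∧ s (m - 1) = off ∧ s m = off ∧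
    e 0 = 0 ∧ e m = h ∧
    ∀ k, 1 ≤ k → k ≤ m →
      e (k - 1) ≤ e k ∧
      T (s (k - 1)) (s k) = ((e k - e (k - 1) : ℕ) : ℕ∞) ∧
      ∀ i : Fin h, e (k - 1) ≤ (i : ℕ) → (i : ℕ) < e k → Ω i = (s (k - 1), s k)

/-- A solution `(σ, Ω)` of the job list `p` is feasible if `Ω` is a valid state
profile, every processing window `[σ j, σ j + p j)` is contained in `{0, …, h-1}`,
the processing windows are pairwise disjoint, and `Ω i = (proc, proc)` for every
interval `i` lying in some processing window. -/
def Feasible (off proc : S) (T : S → S → ℕ∞) {h n : ℕ}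
    (p : Fin n → ℕ) (σ : Fin n → ℕ) (Ω : Fin h → S × S) : Prop :=
  ValidProfile off T Ω ∧
  (∀ j, σ j + p j ≤ h) ∧
  (∀ j j' : Fin n, j ≠ j' → ∀ i : ℕ,
    ¬(σ j ≤ i ∧ i < σ j + p j ∧ σ j' ≤ i ∧ i < σ j' + p j')) ∧
  (∀ j : Fin n, ∀ i : Fin h, σ j ≤ (i : ℕ) → (i : ℕ) < σ j + p j → Ω i = (proc, proc))

/-- The total energy cost of a solution: `TEC(σ, Ω) = Σ_{i<h} c i • P (Ω i)`. -/
def TEC (P : S → S → ℚ) {h : ℕ} (c : Fin h → ℚ) (Ω : Fin h → S × S) : ℚ :=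
  ∑ i, c i * P (Ω i).1 (Ω i).2

/-- A permutation `π` of `Fin n` orders `(σ, Ω)` if
`σ (π ℓ) + p (π ℓ) ≤ σ (π (ℓ+1))` for all `ℓ < n - 1`. -/
def Orders {n : ℕ} (p : Fin n → ℕ) (σ : Fin n → ℕ) (π : Equiv.Perm (Fin n)) : Prop :=
  ∀ (ℓ : ℕ) (h1 : ℓ + 1 < n),
    σ (π ⟨ℓ, by omega⟩) + p (π ⟨ℓ, by omega⟩) ≤ σ (π ⟨ℓ + 1, h1⟩)

/-- `TEC*(p, π)`: the optimal total energy cost over feasible solutions of `p`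
ordered by `π` (`⊤` if none exists). -/
noncomputable def TECopt (off proc : S) (T : S → S → ℕ∞) (P : S → S → ℚ)
    {h n : ℕ} (c : Fin h → ℚ) (p : Fin n → ℕ) (π : Equiv.Perm (Fin n)) : WithTop ℚ :=
  infQ {x : ℚ | ∃ (σ : Fin n → ℕ) (Ω : Fin h → S × S),
    Feasible off proc T p σ Ω ∧ Orders p σ π ∧ x = TEC P c Ω}

/-- The optimal total energy cost over all feasible solutions of `p`
(with no prescribed order of the jobs). -/
noncomputable def TECglobal (off proc : S) (T : S → S → ℕ∞) (P : S → S → ℚ)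
    {h n : ℕ} (c : Fin h → ℚ) (p : Fin n → ℕ) : WithTop ℚ :=
  infQ {x : ℚ | ∃ (σ : Fin n → ℕ) (Ω : Fin h → S × S),
    Feasible off proc T p σ Ω ∧ x = TEC P c Ω}

/-- The jobs not fixed by the prefix `ρ`, i.e. those outside the range of `ρ`. -/
def unfixed {n k : ℕ} (ρ : Fin k → Fin n) : Finset (Fin n) :=
  Finset.univ.filter fun j => ∀ ℓ, ρ ℓ ≠ j

/-- The number of jobs of the `d`-relaxation of `(p, ρ)`:
`k + (Σ_{j ∉ range ρ} p j) / d`. -/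
def relaxLen {n k : ℕ} (p : Fin n → ℕ) (ρ : Fin k → Fin n) (d : ℕ) : ℕ :=
  k + (∑ j ∈ unfixed ρ, p j) / d

/-- The `d`-relaxation of `(p, ρ)`: the fixed jobs `p (ρ 0), …, p (ρ (k-1))`
followed by `(Σ_{j ∉ range ρ} p j) / d` jobs of processing time `d`. -/
def relax {n k : ℕ} (p : Fin n → ℕ) (ρ : Fin k → Fin n) (d : ℕ) :
    Fin (relaxLen p ρ d) → ℕ :=
  fun ℓ => if hl : (ℓ : ℕ) < k then p (ρ ⟨ℓ, hl⟩) else d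

/-- The greatest common divisor of the processing times of the unfixed jobs. -/
def gcdUnfixed {n k : ℕ} (p : Fin n → ℕ) (ρ : Fin k → Fin n) : ℕ :=
  (unfixed ρ).gcd p

/-- The optimal switching cost `κ(s, a, s', b)`: the infimum over all chains
`s = u 0, u 1, …, u r = s'` with `T (u (t-1)) (u t) ≠ ∞` for every `t` and
`Σ_t T (u (t-1)) (u t) = b - a` of the total energy cost of the corresponding
consecutive blocks filling `{a, …, b-1}`. -/
noncomputable def kappa (T : S → S → ℕ∞) (P : S → S → ℚ) {h : ℕ} (c : Fin h → ℚ)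
    (s : S) (a : ℕ) (s' : S) (b : ℕ) : WithTop ℚ :=
  infQ {x : ℚ | ∃ (r : ℕ) (u : ℕ → S) (e : ℕ → ℕ),
    u 0 = s ∧ u r = s' ∧ e 0 = a ∧ e r = b ∧
    (∀ t, 1 ≤ t → t ≤ r → e (t - 1) ≤ e t ∧
      T (u (t - 1)) (u t) = ((e t - e (t - 1) : ℕ) : ℕ∞)) ∧
    x = ∑ t ∈ Finset.Icc 1 r, ∑ i ∈ Finset.Ico (e (t - 1)) (e t),
          (if hi : i < h then c ⟨i, hi⟩ else 0) * P (u (t - 1)) (u t)}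

/-- `d(s, s')`: the minimal total duration `Σ_t T (u (t-1)) (u t)` over chains
`s = u 0, …, u r = s'` with `r ≥ 1` and all transition times finite. -/
noncomputable def minDur (T : S → S → ℕ∞) (s s' : S) : ℕ∞ :=
  sInf {x : ℕ∞ | ∃ (r : ℕ) (u : ℕ → S), 1 ≤ r ∧ u 0 = s ∧ u r = s' ∧
    (∀ t, 1 ≤ t → t ≤ r → T (u (t - 1)) (u t) ≠ ⊤) ∧
    x = ∑ t ∈ Finset.Icc 1 r, T (u (t - 1)) (u t)}

/-- `(a, b)` (as half-open intervals `[a k, b k)`, `k : Fin K`) enumerates the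
maximal blocks of consecutive intervals `i` with `Ω i = (proc, proc)`:
every block is nonempty, consists of processing intervals only, every processing
interval lies in some block, and the (sorted) blocks are strictly separated. -/
def IsMaxProcBlocks (proc : S) {h : ℕ} (Ω : Fin h → S × S) {K : ℕ}
    (a b : Fin K → ℕ) : Prop :=
  (∀ k, a k < b k ∧ b k ≤ h) ∧
  (∀ k, ∀ i : Fin h, a k ≤ (i : ℕ) → (i : ℕ) < b k → Ω i = (proc, proc)) ∧
  (∀ i : Fin h, Ω i = (proc, proc) → ∃ k, a k ≤ (i : ℕ) ∧ (i : ℕ) < b k) ∧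
  (∀ k k' : Fin K, k < k' → b k < a k')

/-- The infimum of a finite set of rationals is a lower bound of it. -/
theorem infQ_le_of_mem {A : Set ℚ} (hA : A.Finite) {x : ℚ} (hx : x ∈ A) :
    infQ A ≤ x := by
  have h : ∃ x ∈ A, ∀ y ∈ A, x ≤ y := Set.exists_min_image A id hA ⟨x, hx⟩
  rw [infQ, dif_pos h]
  exact WithTop.coe_le_coe.2 (h.choose_spec.2 x hx)

/-- The infimum is antitone, provided that the larger set is finite. -/
theorem infQ_anti {A B : Set ℚ} (hA : A.Finite) (hBA : B ⊆ A) : infQ A ≤ infQ B := by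
  by_cases h : ∃ x ∈ B, ∀ y ∈ B, x ≤ y
  · rw [infQ.eq_1 B, dif_pos h]
    exact infQ_le_of_mem hA (hBA h.choose_spec.1)
  · rw [infQ.eq_1 B, dif_neg h]
    exact le_top

/-- Only finitely many total energy costs occur. -/
theorem finite_range_TEC [Finite S] (P : S → S → ℚ) {h : ℕ} (c : Fin h → ℚ) :
    (Set.range (TEC P c)).Finite :=
  Set.finite_range _

/-- If jobs are processed in the order of their indices, each one ends before every later
one starts. -/
theorem Orders.add_le_of_lt {n : ℕ} {p σ : Fin n → ℕ} (h : Orders p σ (Equiv.refl _))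
    {a b : Fin n} (hab : a < b) : σ a + p a ≤ σ b := by
  obtain ⟨a, ha⟩ := a
  obtain ⟨b, hb⟩ := b
  rw [Fin.mk_lt_mk, ← Nat.succ_le_iff] at hab
  induction b, hab using Nat.le_induction with
  | base => exact h a hb
  | succ b hab ih => exact (ih (by omega)).trans ((Nat.le_add_right _ _).trans (h b hb))

/-- Feasibility passes to jobs whose processing windows are subintervals of the original
windows, as long as the new windows are consecutive. -/
theorem Feasible.refine {off proc : S} {T : S → S → ℕ∞} {h n m : ℕ} {p σ : Fin n → ℕ}
    {Ω : Fin h → S × S} (hf : Feasible off proc T p σ Ω) {p' σ' : Fin m → ℕ}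
    (hsub : ∀ j, ∃ k, σ k ≤ σ' j ∧ σ' j + p' j ≤ σ k + p k)
    (hord : Orders p' σ' (Equiv.refl _)) : Feasible off proc T p' σ' Ω := by
  obtain ⟨hv, hle, -, hproc⟩ := hf
  refine ⟨hv, fun j => ?_, fun j j' hne i hi => ?_, fun j i h1 h2 => ?_⟩
  · obtain ⟨k, -, hk⟩ := hsub j
    exact hk.trans (hle k)
  · rcases lt_or_gt_of_ne hne with hlt | hlt
    · have := hord.add_le_of_lt hlt
      omega
    · have := hord.add_le_of_lt hlt
      omega
  · obtain ⟨k, hk1, hk2⟩ := hsub j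
    exact hproc k i (hk1.trans h1) (h2.trans_le hk2)

/-- splitting one job of the sequence into equal consecutive pieces
can only decrease the optimal total energy cost for the fixed sequence. -/
theorem split_job_le {S : Type*} [Fintype S] (off proc : S)
    (T : S → S → ℕ∞) (hT : ∀ s : S, T s s = 1)
    (P : S → S → ℚ) {h : ℕ} (hh : 2 ≤ h) (c : Fin h → ℚ)
    {n : ℕ} (p : Fin n → ℕ) (hp : ∀ j, 1 ≤ p j)
    (π : Equiv.Perm (Fin n)) (ℓ₀ : Fin n) (d : ℕ) (hd : 1 ≤ d)
    (hdvd : d ∣ p (π ℓ₀)) :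
    TECopt off proc T P c
      (fun ℓ : Fin (n - 1 + p (π ℓ₀) / d) =>
        if h1 : (ℓ : ℕ) < (ℓ₀ : ℕ) then
          p (π ⟨(ℓ : ℕ), by have := ℓ₀.isLt; omega⟩)
        else if h2 : (ℓ : ℕ) < (ℓ₀ : ℕ) + p (π ℓ₀) / d then d
        else p (π ⟨(ℓ : ℕ) - p (π ℓ₀) / d + 1,
          by have := ℓ.isLt; have := ℓ₀.isLt; omega⟩))
      (Equiv.refl _) ≤ TECopt off proc T P c p π := by
  refine infQ_anti ((finite_range_TEC P c).subset ?_) ?_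
  · rintro x ⟨σ, Ω, -, -, rfl⟩
    exact ⟨Ω, rfl⟩
  rintro x ⟨σ, Ω, hf, ho, rfl⟩
  have hℓ := ℓ₀.isLt
  have hq : d * (p (π ℓ₀) / d) = p (π ℓ₀) := Nat.mul_div_cancel' hdvd
  have hq1 : 1 ≤ p (π ℓ₀) / d := Nat.div_pos (Nat.le_of_dvd (hp _) hdvd) hd
  have ho' : ∀ a b : Fin n, (b : ℕ) = a + 1 → σ (π a) + p (π a) ≤ σ (π b) := by
    rintro ⟨a, ha⟩ ⟨b, hb⟩ hab
    obtain rfl : b = a + 1 := hab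
    exact ho a hb
  let σ' : Fin (n - 1 + p (π ℓ₀) / d) → ℕ := fun ℓ =>
    if _ : (ℓ : ℕ) < ℓ₀ then σ (π ⟨ℓ, by omega⟩)
    else if _ : (ℓ : ℕ) < ℓ₀ + p (π ℓ₀) / d then σ (π ℓ₀) + d * (ℓ - ℓ₀)
    else σ (π ⟨ℓ - p (π ℓ₀) / d + 1, by omega⟩)
  have piece_le : ∀ k, k < p (π ℓ₀) / d → d * k + d ≤ p (π ℓ₀) := fun k hk => by
    rw [← Nat.mul_succ]
    exact (Nat.mul_le_mul_left d hk).trans_eq hq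
  refine ⟨σ', Ω, hf.refine (fun ℓ => ?_) ?ord, ?ord, rfl⟩
  · dsimp only [σ']
    split_ifs with h1 h2
    · exact ⟨_, le_rfl, le_rfl⟩
    · refine ⟨π ℓ₀, Nat.le_add_right _ _, ?_⟩
      have := piece_le (ℓ - ℓ₀) (by omega)
      omega
    · exact ⟨_, le_rfl, le_rfl⟩
  · intro ℓ hlt
    dsimp only [σ', Equiv.refl_apply]
    split_ifs with h1 h2 h3 h4 h5 h6
    any_goals omega
    · exact ho' _ _ rfl
    · exact (ho' _ ℓ₀ (by simp only; omega)).trans (Nat.le_add_right _ _)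
    · rw [Nat.sub_add_comm (by omega), Nat.mul_succ, add_assoc]
    · have := piece_le (ℓ - ℓ₀) (by omega)
      rw [add_assoc]
      exact (Nat.add_le_add_left this _).trans (ho' _ _ (by simp only; omega))
    · exact ho' _ _ (by simp only; omega)

end TOU
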